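/- arXiv:2101.07739 — 5 statements merged into one kernel-verified Lean document; each statement's English description precedes it below -/
import Mathlib

section
/- Let μ be a locally finite measure on ℝ^d with density f, let W ⊂ ℝ^d be compact, and assume there is a bounded open set A ⊃ W with f_min := inf_{x∈A} f(x) > 0 and sup_{x∈A} f(x) < ∞. Then for every u ∈ ℝ there exists t₀ > 0 such that for all x ∈ W and t > t₀ the equations t μ(B(x, 2v)) = u + log t and 2^d t μ(B(x, q)) = u + log t have unique solutions v = v_t(x, u) ≥ 0 and q = q_t(x, u) ≥ 0, and these satisfy max{ v_t(x, u), q_t(x, u) } ≤ ( (u + log t) / (2^d f_min k_d t) )^{1/d}, where k_d is the volume of the d-dimensional unit ball. -/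
open MeasureTheory Filter Topology
open scoped ENNReal NNReal

noncomputable section

/-- Euclidean space `ℝ^d`. -/
abbrev Euc (d : ℕ) := EuclideanSpace ℝ (Fin d)


theorem vor_diff_bounds {d : ℕ} (hd : 0 < d)
    (f : Euc d → ℝ)
    (μ : Measure (Euc d)) (hμ : μ = volume.withDensity fun x => ENNReal.ofReal (f x))
    [IsLocallyFiniteMeasure μ] (A : Set (Euc d)) (m M : ℝ) (hm : 0 ≤ m) (hM : 0 ≤ M)
    (hmA : ∀ y ∈ A, m ≤ f y) (hMA : ∀ y ∈ A, f y ≤ M)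
    (x : Euc d) (r s : ℝ) (hr : 0 ≤ r) (hrs : r ≤ s) (hs : Metric.ball x s ⊆ A) :
    m * (volume (Metric.ball (0 : Euc d) 1)).toReal * (s ^ d - r ^ d)
      ≤ (μ (Metric.ball x s)).toReal - (μ (Metric.ball x r)).toReal ∧
    (μ (Metric.ball x s)).toReal - (μ (Metric.ball x r)).toReal ≤
      M * (volume (Metric.ball (0 : Euc d) 1)).toReal * (s ^ d - r ^ d) := by
  have hvol : ∀ a : ℝ, 0 ≤ a → (volume : Measure (Euc d)).real (Metric.ball x a)
      = a ^ d * (volume (Metric.ball (0 : Euc d) 1)).toReal := by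
    intro a ha
    haveI : Nonempty (Fin d) := ⟨⟨0, hd⟩⟩
    haveI : Nontrivial (Euc d) := inferInstanceAs (Nontrivial (EuclideanSpace ℝ (Fin d)))
    rw [Measure.real, Measure.addHaar_ball _ _ ha, ENNReal.toReal_mul,
      ENNReal.toReal_ofReal (by positivity)]
    simp
  have hsub : Metric.ball x r ⊆ Metric.ball x s := Metric.ball_subset_ball hrs
  have hmeas : MeasurableSet (Metric.ball x s \ Metric.ball x r) :=
    Metric.isOpen_ball.measurableSet.diff Metric.isOpen_ball.measurableSet
  have hfin : μ (Metric.ball x s) ≠ ∞ := measure_ball_lt_top.ne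
  have hfinr : μ (Metric.ball x r) ≠ ∞ := measure_ball_lt_top.ne
  have hvfin : (volume : Measure (Euc d)) (Metric.ball x s) ≠ ∞ := measure_ball_lt_top.ne
  have e1 : (μ (Metric.ball x s)).toReal - (μ (Metric.ball x r)).toReal
      = (μ (Metric.ball x s \ Metric.ball x r)).toReal :=
    (measureReal_sdiff hsub Metric.isOpen_ball.measurableSet hfin).symm
  have e2 : (volume (Metric.ball (0 : Euc d) 1)).toReal * (s ^ d - r ^ d)
      = ((volume : Measure (Euc d)) (Metric.ball x s \ Metric.ball x r)).toReal := by
    have := measureReal_sdiff (μ := (volume : Measure (Euc d))) hsub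
      Metric.isOpen_ball.measurableSet measure_ball_lt_top.ne
    rw [hvol _ hr, hvol _ (hr.trans hrs)] at this
    rw [Measure.real] at this
    rw [this]; ring
  have hv' : (volume : Measure (Euc d)) (Metric.ball x s \ Metric.ball x r) ≠ ∞ :=
    measure_ne_top_of_subset Set.diff_subset hvfin
  have hμ' : μ (Metric.ball x s \ Metric.ball x r) ≠ ∞ :=
    measure_ne_top_of_subset Set.diff_subset hfin
  have e3 : μ (Metric.ball x s \ Metric.ball x r)
      = ∫⁻ y in Metric.ball x s \ Metric.ball x r, ENNReal.ofReal (f y) := by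
    rw [hμ, withDensity_apply _ hmeas]
  rw [e1, mul_assoc, mul_assoc, e2]
  constructor
  · have : ENNReal.ofReal m * (volume : Measure (Euc d)) (Metric.ball x s \ Metric.ball x r)
        ≤ μ (Metric.ball x s \ Metric.ball x r) := by
      rw [e3, ← setLIntegral_const]
      exact setLIntegral_mono' hmeas fun y hy => ENNReal.ofReal_le_ofReal (hmA y (hs hy.1))
    have := ENNReal.toReal_mono hμ' this
    rwa [ENNReal.toReal_mul, ENNReal.toReal_ofReal hm] at this
  · have : μ (Metric.ball x s \ Metric.ball x r) ≤
        ENNReal.ofReal M * (volume : Measure (Euc d)) (Metric.ball x s \ Metric.ball x r) := by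
      rw [e3, ← setLIntegral_const]
      exact setLIntegral_mono' hmeas fun y hy => ENNReal.ofReal_le_ofReal (hMA y (hs hy.1))
    have := ENNReal.toReal_mono (ENNReal.mul_ne_top ENNReal.ofReal_ne_top hv') this
    rwa [ENNReal.toReal_mul, ENNReal.toReal_ofReal hM] at this

theorem vor_core {d : ℕ} (hd : 0 < d) (g : ℝ → ℝ) (hg : Monotone g) (h0 : g 0 = 0)
    (a b δ : ℝ) (ha : 0 < a) (hδ : 0 < δ)
    (hl : ∀ r s, 0 ≤ r → r ≤ s → s ≤ δ → a * (s ^ d - r ^ d) ≤ g s - g r)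
    (hu : ∀ r s, 0 ≤ r → r ≤ s → s ≤ δ → g s - g r ≤ b * (s ^ d - r ^ d))
    (c : ℝ) (hc : 0 < c) (hcδ : c < a * δ ^ d) :
    (∃! r, 0 ≤ r ∧ g r = c) ∧ ∀ r, 0 ≤ r → g r = c → a * r ^ d ≤ c := by
  have hd' : d ≠ 0 := hd.ne'
  have hgδ : c < g δ := by
    have := hl 0 δ le_rfl hδ.le le_rfl
    simp [h0, hd'] at this; linarith
  have hlt : ∀ r, g r = c → r < δ := by
    intro r hr
    by_contra hh
    have := hg (not_lt.1 hh)
    linarith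
  have hcont : ContinuousOn g (Set.Icc 0 δ) := by
    have habs : ∀ r ∈ Set.Icc 0 δ, ∀ s ∈ Set.Icc 0 δ,
        |g s - g r| ≤ |b * (s ^ d - r ^ d)| := by
      intro r hr s hs
      rcases le_total r s with h | h
      · have h1 := hu r s hr.1 h hs.2
        have h2 := hg h
        rw [abs_of_nonneg (by linarith)]
        exact h1.trans (le_abs_self _)
      · have h1 := hu s r hs.1 h hr.2
        have h2 := hg h
        rw [abs_of_nonpos (by linarith)]
        have h3 := neg_le_abs (b * (s ^ d - r ^ d))
        linarith
    intro r hr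
    rw [ContinuousWithinAt, tendsto_iff_dist_tendsto_zero]
    have hz : Tendsto (fun s => |b * (s ^ d - r ^ d)|) (𝓝[Set.Icc 0 δ] r) (𝓝 0) := by
      have : Continuous (fun s : ℝ => |b * (s ^ d - r ^ d)|) := by fun_prop
      have h := this.tendsto r
      simp only [sub_self, mul_zero, abs_zero] at h
      exact h.mono_left nhdsWithin_le_nhds
    refine squeeze_zero' (Eventually.of_forall fun _ => dist_nonneg) ?_ hz
    filter_upwards [self_mem_nhdsWithin] with s hs
    rw [Real.dist_eq]
    exact habs r hr s hs
  refine ⟨?_, ?_⟩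
  · obtain ⟨r, hr, hrc⟩ := intermediate_value_Icc hδ.le hcont
      (show c ∈ Set.Icc (g 0) (g δ) from ⟨by rw [h0]; exact hc.le, hgδ.le⟩)
    have key : ∀ p q, 0 ≤ p → p < q → g p = c → g q = c → False := by
      intro p q hp hpq h1 h2
      have h3 := hl p q hp hpq.le (hlt q h2).le
      have h4 : p ^ d < q ^ d := pow_lt_pow_left₀ hpq hp hd'
      have : 0 < a * (q ^ d - p ^ d) := mul_pos ha (by linarith)
      linarith
    refine ⟨r, ⟨hr.1, hrc⟩, ?_⟩
    rintro s ⟨hs, hsc⟩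
    rcases lt_trichotomy s r with h | h | h
    · exact (key s r hs h hsc hrc).elim
    · exact h
    · exact (key r s hr.1 h hrc hsc).elim
  · intro r hr hrc
    have := hl 0 r le_rfl hr (hlt r hrc).le
    simp [h0, hd', hrc] at this
    exact this

/-- (Lemma 5 of the paper.) For all `u ∈ ℝ` there is `t₀ > 0` such that
for all `x ∈ W` and `t > t₀` the equations `t μ(B(x, 2v)) = u + log t` and
`2^d t μ(B(x, q)) = u + log t` have unique non-negative solutions `v_t(x,u)` and
`q_t(x,u)`, which satisfy
`max{v_t(x,u), q_t(x,u)} ≤ ((u + log t)/(2^d f_min k_d t))^{1/d}`. -/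
theorem voronoi_radius_equation_solutions
    {d : ℕ} (hd : 0 < d)
    -- the locally finite measure `μ` with density `f`
    (f : Euc d → ℝ) (hfm : Measurable f) (hf0 : ∀ x, 0 ≤ f x)
    (μ : Measure (Euc d)) (hμ : μ = volume.withDensity fun x => ENNReal.ofReal (f x))
    [IsLocallyFiniteMeasure μ]
    -- the compact set `W` and the bounded open set `A ⊇ W`
    (W A : Set (Euc d)) (hW : IsCompact W)
    (hA : IsOpen A) (hAb : Bornology.IsBounded A) (hWA : W ⊆ A)
    (hfmin : 0 < sInf (f '' A)) (hfmax : BddAbove (f '' A)) :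
    ∀ u : ℝ, ∃ t₀ > (0 : ℝ), ∀ x ∈ W, ∀ t : ℝ, t₀ < t →
      (∃! v : ℝ, 0 ≤ v ∧
          t * (μ (Metric.ball x (2 * v))).toReal = u + Real.log t) ∧
      (∃! q : ℝ, 0 ≤ q ∧
          2 ^ d * t * (μ (Metric.ball x q)).toReal = u + Real.log t) ∧
      (∀ v q : ℝ,
        (0 ≤ v ∧ t * (μ (Metric.ball x (2 * v))).toReal = u + Real.log t) →
        (0 ≤ q ∧ 2 ^ d * t * (μ (Metric.ball x q)).toReal = u + Real.log t) →
        max v q ≤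
          ((u + Real.log t) /
              (2 ^ d * sInf (f '' A) * (volume (Metric.ball (0 : Euc d) 1)).toReal * t))
            ^ ((1 : ℝ) / d)) := by
  intro u
  have hk : 0 < (volume (Metric.ball (0 : Euc d) 1)).toReal :=
    ENNReal.toReal_pos (Metric.measure_ball_pos _ _ one_pos).ne' measure_ball_lt_top.ne
  set k := (volume (Metric.ball (0 : Euc d) 1)).toReal with hkdef
  set m := sInf (f '' A) with hmdef
  have hmA : ∀ y ∈ A, m ≤ f y := fun y hy =>
    csInf_le ⟨0, by rintro _ ⟨z, -, rfl⟩; exact hf0 z⟩ ⟨y, hy, rfl⟩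
  obtain ⟨M, hM⟩ := hfmax
  have hMA : ∀ y ∈ A, f y ≤ max M 0 := fun y hy => (hM ⟨y, hy, rfl⟩).trans (le_max_left _ _)
  obtain ⟨δ, hδ, hδA⟩ := hW.exists_thickening_subset_open hA hWA
  have hball : ∀ x ∈ W, Metric.ball x δ ⊆ A := fun x hx =>
    (Metric.ball_subset_thickening hx δ).trans hδA
  have hak : 0 < m * k * δ ^ d := by positivity
  have ev1 : ∀ᶠ t : ℝ in atTop, 0 < u + Real.log t :=
    (tendsto_atTop_add_const_left _ u Real.tendsto_log_atTop).eventually_gt_atTop 0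
  have ev2 : ∀ᶠ t : ℝ in atTop, (u + Real.log t) / t < m * k * δ ^ d := by
    have h1 : Tendsto (fun t : ℝ => u / t) atTop (𝓝 0) := tendsto_const_nhds.div_atTop tendsto_id
    have h2 : Tendsto (fun t : ℝ => Real.log t / t) atTop (𝓝 0) :=
      Real.isLittleO_log_id_atTop.tendsto_div_nhds_zero
    have h3 := h1.add h2
    rw [add_zero] at h3
    filter_upwards [h3.eventually_lt_const hak] with t ht
    rwa [add_div]
  obtain ⟨T, hT⟩ := eventually_atTop.1 (ev1.and ev2)
  refine ⟨max T 1, by positivity, ?_⟩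
  intro x hx t ht
  have htT : T ≤ t := (le_max_left _ _).trans ht.le
  have ht0 : 0 < t := lt_of_lt_of_le one_pos ((le_max_right _ _).trans ht.le)
  obtain ⟨hc, hcl⟩ := hT t htT
  have hg : Monotone fun r => (μ (Metric.ball x r)).toReal := fun r s h =>
    ENNReal.toReal_mono measure_ball_lt_top.ne (measure_mono (Metric.ball_subset_ball h))
  have core := vor_core hd (fun r => (μ (Metric.ball x r)).toReal) hg (by simp)
    (m * k) (max M 0 * k) δ (by positivity) hδ
    (fun r s hr hrs hs => (vor_diff_bounds hd f μ hμ A m (max M 0) hfmin.le (le_max_right _ _)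
      hmA hMA x r s hr hrs ((Metric.ball_subset_ball hs).trans (hball x hx))).1)
    (fun r s hr hrs hs => (vor_diff_bounds hd f μ hμ A m (max M 0) hfmin.le (le_max_right _ _)
      hmA hMA x r s hr hrs ((Metric.ball_subset_ball hs).trans (hball x hx))).2)
  have h2d : (1 : ℝ) ≤ 2 ^ d := one_le_pow₀ (by norm_num)
  have hc1 : 0 < (u + Real.log t) / t := by positivity
  have hc2 : 0 < (u + Real.log t) / t / 2 ^ d := by positivity
  obtain ⟨⟨r1, ⟨hr1, hr1c⟩, hr1u⟩, hb1⟩ := core _ hc1 hcl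
  obtain ⟨⟨r2, ⟨hr2, hr2c⟩, hr2u⟩, hb2⟩ := core _ hc2
    (lt_of_le_of_lt (div_le_self hc1.le h2d) hcl)
  have eq1 : ∀ z : ℝ, t * z = u + Real.log t ↔ z = (u + Real.log t) / t := by
    intro z
    rw [eq_div_iff ht0.ne', mul_comm]
  have eq2 : ∀ z : ℝ, 2 ^ d * t * z = u + Real.log t ↔ z = (u + Real.log t) / t / 2 ^ d := by
    intro z
    rw [div_div, eq_div_iff (by positivity)]
    constructor <;> intro h <;> linarith
  simp only [eq1, eq2]
  have fin : ∀ r : ℝ, 0 ≤ r → m * k * r ^ d ≤ (u + Real.log t) / t / 2 ^ d →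
      r ≤ ((u + Real.log t) / (2 ^ d * m * k * t)) ^ ((1 : ℝ) / d) := by
    intro r hr h
    have h1 : r ^ d ≤ (u + Real.log t) / (2 ^ d * m * k * t) := by
      have : (u + Real.log t) / (2 ^ d * m * k * t) = (u + Real.log t) / t / 2 ^ d / (m * k) := by
        field_simp
      rw [this, le_div_iff₀ (by positivity)]
      linarith
    have h2 : r = (r ^ d) ^ ((1 : ℝ) / d) := by
      rw [one_div, Real.pow_rpow_inv_natCast hr hd.ne']
    rw [h2]
    exact Real.rpow_le_rpow (by positivity) h1 (by positivity)
  refine ⟨⟨r1 / 2, ⟨by positivity, ?_⟩, ?_⟩, ⟨r2, ⟨hr2, hr2c⟩, hr2u⟩, ?_⟩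
  · rw [mul_div_cancel₀ r1 two_ne_zero]; exact hr1c
  · rintro v ⟨hv, hvc⟩
    have := hr1u (2 * v) ⟨by positivity, hvc⟩
    linarith
  · rintro v q ⟨hv, hvc⟩ ⟨hq, hqc⟩
    refine max_le (fin v hv ?_) (fin q hq (hb2 q hq hqc))
    have := hb1 (2 * v) (by positivity) hvc
    rw [le_div_iff₀ (by positivity)]
    rw [mul_pow] at this
    linarith
end
end

section
/- Let μ be an absolutely continuous measure on ℝ^d with continuous density f, let W ⊂ ℝ^d be a compact convex set with f > 0 on W, and set T = [0, μ(W)]. Let g : W × T → [0, ∞) be defined by the equation μ(B(x, g(x, u))) = u, which admits a unique solution for every (x, u) ∈ W × T. Then for every u ∈ T the function x ↦ g(x, u) is continuous on W, and lim_{u→0⁺} sup_{x∈W} |g(x, u)| = 0. -/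
open MeasureTheory Filter Topology
open scoped ENNReal NNReal

noncomputable section

/-- (Lemma 6 of the paper.) Let `g : W × T → [0, ∞)`, `T = [0, μ(W)]`, be
defined by `μ(B(x, g(x,u))) = u`.  Then `g(·, u)` is continuous on `W` for every `u ∈ T`,
and `sup_{x ∈ W} |g(x, u)| → 0` as `u → 0⁺`. -/
theorem voronoi_gauge_continuous
    {d : ℕ} (hd : 0 < d)
    -- the absolutely continuous measure `μ` with continuous density `f`
    (f : Euc d → ℝ) (hfc : Continuous f) (hf0 : ∀ x, 0 ≤ f x)
    (μ : Measure (Euc d)) (hμ : μ = volume.withDensity fun x => ENNReal.ofReal (f x))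
    -- the compact convex set `W`, with `f > 0` on `W`
    (W : Set (Euc d)) (hW : IsCompact W) (hWc : Convex ℝ W) (hfW : ∀ x ∈ W, 0 < f x)
    -- `g` is the unique solution of `μ(B(x, g(x,u))) = u`
    (g : Euc d → ℝ → ℝ)
    (huniq : ∀ x ∈ W, ∀ u : ℝ, 0 ≤ u → u ≤ (μ W).toReal →
      ∃! r : ℝ, 0 ≤ r ∧ (μ (Metric.ball x r)).toReal = u)
    (hg : ∀ x ∈ W, ∀ u : ℝ, 0 ≤ u → u ≤ (μ W).toReal →
      0 ≤ g x u ∧ (μ (Metric.ball x (g x u))).toReal = u) :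
    -- continuity of `g(·, u)` on `W`
    (∀ u : ℝ, 0 ≤ u → u ≤ (μ W).toReal → ContinuousOn (fun x => g x u) W) ∧
    -- `lim_{u → 0⁺} sup_{x ∈ W} |g(x, u)| = 0`
    (∀ ε : ℝ, 0 < ε → ∃ u₀ > (0 : ℝ), ∀ u : ℝ, 0 < u → u ≤ u₀ → u ≤ (μ W).toReal →
      ∀ x ∈ W, |g x u| ≤ ε) := by
  have hloc : IsLocallyFiniteMeasure μ := by
    rw [hμ]; exact IsLocallyFiniteMeasure.withDensity_ofReal hfc
  have hmono : ∀ (x y : Euc d) (r s : ℝ), r + dist x y ≤ s →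
      (μ (Metric.ball x r)).toReal ≤ (μ (Metric.ball y s)).toReal := by
    intro x y r s h
    apply ENNReal.toReal_mono measure_ball_lt_top.ne
    apply measure_mono
    exact Metric.ball_subset_ball' h
  have hmono' : ∀ (x : Euc d) (r s : ℝ), r ≤ s →
      (μ (Metric.ball x r)).toReal ≤ (μ (Metric.ball x s)).toReal := by
    intro x r s h
    exact hmono x x r s (by simpa using h)
  have hne : ∀ x ∈ W, ∀ u : ℝ, 0 ≤ u → u ≤ (μ W).toReal → ∀ r, 0 ≤ r → r ≠ g x u →
      (μ (Metric.ball x r)).toReal ≠ u := by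
    intro x hx u hu hu' r hr hrg h
    exact hrg ((huniq x hx u hu hu').unique ⟨hr, h⟩ (hg x hx u hu hu'))
  constructor
  · intro u hu hu' x hx
    rw [Metric.continuousWithinAt_iff]
    intro ε hε
    refine ⟨ε / 4, by positivity, ?_⟩
    intro y hy hyx
    obtain ⟨hx0, hxu⟩ := hg x hx u hu hu'
    obtain ⟨hy0, hyu⟩ := hg y hy u hu hu'
    have hyx' : dist x y < ε / 4 := by rwa [dist_comm]
    rw [Real.dist_eq, abs_lt]
    constructor
    · by_contra! h
      have h1 := hmono y x (g y u) (g x u - ε / 2) (by linarith)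
      have h2 := hmono' x (g x u - ε / 2) (g x u) (by linarith)
      exact hne x hx u hu hu' (g x u - ε / 2) (by linarith) (by linarith) (by linarith)
    · by_contra! h
      have h1 := hmono x y (g x u + ε / 2) (g y u) (by linarith)
      have h2 := hmono' x (g x u) (g x u + ε / 2) (by linarith)
      exact hne x hx u hu hu' (g x u + ε / 2) (by linarith) (by linarith) (by linarith)
  · intro ε hε
    have key : ∃ u₀ > (0 : ℝ), ∀ x ∈ W, u₀ ≤ (μ (Metric.ball x ε)).toReal := by
      refine hW.induction_on (p := fun s => ∃ u₀ > (0 : ℝ), ∀ x ∈ s,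
        u₀ ≤ (μ (Metric.ball x ε)).toReal) ⟨1, one_pos, by simp⟩ ?_ ?_ ?_
      · rintro s t hst ⟨a, ha, h⟩
        exact ⟨a, ha, fun x hx => h x (hst hx)⟩
      · rintro s t ⟨a, ha, h⟩ ⟨b, hb, h'⟩
        refine ⟨min a b, lt_min ha hb, ?_⟩
        rintro x (hx | hx)
        · exact (min_le_left _ _).trans (h x hx)
        · exact (min_le_right _ _).trans (h' x hx)
      · intro x hx
        refine ⟨Metric.ball x (ε / 2), mem_nhdsWithin_of_mem_nhds
          (Metric.ball_mem_nhds x (by positivity)), (μ (Metric.ball x (ε / 2))).toReal, ?_, ?_⟩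
        · refine lt_of_le_of_ne ENNReal.toReal_nonneg (Ne.symm ?_)
          intro h
          have := (huniq x hx 0 le_rfl ENNReal.toReal_nonneg).unique
            (y₁ := ε / 2) (y₂ := 0) ⟨by positivity, h⟩ ⟨le_rfl, by simp⟩
          linarith
        · intro y hy
          rw [Metric.mem_ball, dist_comm] at hy
          exact hmono x y _ _ (by linarith)
    obtain ⟨u₀, h0, h⟩ := key
    refine ⟨u₀ / 2, by positivity, ?_⟩
    intro u hu hu1 hu2 x hx
    obtain ⟨hx0, hxu⟩ := hg x hx u hu.le hu2
    rw [abs_of_nonneg hx0]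
    by_contra! hlt
    have h1 := hmono' x ε (g x u) hlt.le
    have h2 := h x hx
    linarith
end
end

section
/- Let μ be an absolutely continuous measure on ℝ^d with continuous density f, let W ⊂ ℝ^d be a compact convex set with f > 0 on W, set T = [0, μ(W)] and β = min_{x∈W} f(x) > 0, and let g : W × T → [0, ∞) be defined by the equation μ(B(x, g(x, u))) = u. Then there exists u₀ ∈ T such that for all u ∈ [0, u₀] and all x ∈ W, g(x, u) ≤ ( 2u / (β k_d) )^{1/d}, where k_d is the volume of the d-dimensional unit ball. -/
open MeasureTheory Filter Topology
open scoped ENNReal NNReal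

noncomputable section

/-- If `f ≥ c` on `B(x, r)`, then `μ(B(x, r)) ≥ c k_d r^d`. -/
theorem ball_lower_bound
    {d : ℕ} (hd : 0 < d)
    (f : Euc d → ℝ) (hfc : Continuous f)
    (μ : Measure (Euc d)) (hμ : μ = volume.withDensity fun x => ENNReal.ofReal (f x))
    (x : Euc d) (r : ℝ) (hr : 0 ≤ r) (c : ℝ) (hc : 0 ≤ c)
    (h : ∀ y ∈ Metric.ball x r, c ≤ f y) :
    c * (r ^ d * (volume (Metric.ball (0 : Euc d) 1)).toReal) ≤
      (μ (Metric.ball x r)).toReal := by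
  have : Nonempty (Fin d) := ⟨⟨0, hd⟩⟩
  have hfin : μ (Metric.ball x r) ≠ ∞ := by
    rw [hμ]
    have : IsLocallyFiniteMeasure (volume.withDensity fun x : Euc d => ENNReal.ofReal (f x)) :=
      IsLocallyFiniteMeasure.withDensity_ofReal hfc
    exact measure_ball_lt_top.ne
  have hle : ENNReal.ofReal c * volume (Metric.ball x r) ≤ μ (Metric.ball x r) := by
    rw [hμ, withDensity_apply _ measurableSet_ball, ← setLIntegral_const]
    exact setLIntegral_mono' measurableSet_ball
      (fun y hy => ENNReal.ofReal_le_ofReal (h y hy))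
  have h2 := ENNReal.toReal_mono hfin hle
  rw [Measure.addHaar_ball _ _ hr] at h2
  simpa [ENNReal.toReal_mul, ENNReal.toReal_ofReal hc, ENNReal.toReal_ofReal, hr] using h2

/-- (Lemma 7 of the paper.) With `g : W × T → [0, ∞)` defined by
`μ(B(x, g(x,u))) = u` and `β = min_{x ∈ W} f(x) > 0`, there is `u₀ ∈ T` such that
`g(x, u) ≤ (2u/(β k_d))^{1/d}` for all `u ∈ [0, u₀]` and all `x ∈ W`, where `k_d` is the
volume of the `d`-dimensional unit ball. -/
theorem voronoi_gauge_bound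
    {d : ℕ} (hd : 0 < d)
    -- the absolutely continuous measure `μ` with continuous density `f`
    (f : Euc d → ℝ) (hfc : Continuous f) (hf0 : ∀ x, 0 ≤ f x)
    (μ : Measure (Euc d)) (hμ : μ = volume.withDensity fun x => ENNReal.ofReal (f x))
    -- the compact convex set `W`, with `f > 0` on `W`
    (W : Set (Euc d)) (hW : IsCompact W) (hWc : Convex ℝ W) (hfW : ∀ x ∈ W, 0 < f x)
    (hWne : W.Nonempty) (hβ : 0 < sInf (f '' W))
    -- `g` solves `μ(B(x, g(x,u))) = u`
    (g : Euc d → ℝ → ℝ)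
    (hg : ∀ x ∈ W, ∀ u : ℝ, 0 ≤ u → u ≤ (μ W).toReal →
      0 ≤ g x u ∧ (μ (Metric.ball x (g x u))).toReal = u) :
    ∃ u₀ : ℝ, 0 ≤ u₀ ∧ u₀ ≤ (μ W).toReal ∧
      ∀ u : ℝ, 0 ≤ u → u ≤ u₀ → ∀ x ∈ W,
        g x u ≤
          (2 * u / (sInf (f '' W) * (volume (Metric.ball (0 : Euc d) 1)).toReal))
            ^ ((1 : ℝ) / d) := by
  set β := sInf (f '' W) with hβdef
  set k := (volume (Metric.ball (0 : Euc d) 1)).toReal with hkdef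
  have hk : 0 < k :=
    ENNReal.toReal_pos (Metric.measure_ball_pos volume _ one_pos).ne' measure_ball_lt_top.ne
  have hβle : ∀ x ∈ W, β ≤ f x := fun x hx =>
    csInf_le (hW.image hfc).bddBelow (Set.mem_image_of_mem f hx)
  obtain ⟨δ, hδ, hsub⟩ := hW.exists_thickening_subset_open
    (isOpen_lt (continuous_const (y := β / 2)) hfc)
    (fun x hx => show β / 2 < f x by linarith [hβle x hx])
  have key : ∀ x ∈ W, ∀ r : ℝ, 0 ≤ r → r ≤ δ →
      β / 2 * (r ^ d * k) ≤ (μ (Metric.ball x r)).toReal := by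
    intro x hx r hr hrδ
    refine ball_lower_bound hd f hfc μ hμ x r hr (β / 2) (by positivity) ?_
    intro y hy
    have : y ∈ Metric.thickening δ W :=
      Metric.mem_thickening_iff.2 ⟨x, hx, lt_of_lt_of_le hy hrδ⟩
    exact le_of_lt (hsub this)
  have hpos : 0 < δ ^ d * k := by positivity
  refine ⟨min (μ W).toReal (β / 4 * (δ ^ d * k)), by positivity, min_le_left _ _, ?_⟩
  intro u hu0 hu x hx
  obtain ⟨hg0, hgu⟩ := hg x hx u hu0 (hu.trans (min_le_left _ _))
  have hu2 := hu.trans (min_le_right _ _)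
  have hfin : μ (Metric.ball x (g x u)) ≠ ∞ := by
    rw [hμ]
    have : IsLocallyFiniteMeasure (volume.withDensity fun x : Euc d => ENNReal.ofReal (f x)) :=
      IsLocallyFiniteMeasure.withDensity_ofReal hfc
    exact measure_ball_lt_top.ne
  have hgδ : g x u ≤ δ := by
    by_contra! hlt
    have h1 := key x hx δ hδ.le le_rfl
    have h2 := ENNReal.toReal_mono hfin (measure_mono (Metric.ball_subset_ball (x := x) hlt.le))
    nlinarith [mul_pos hβ hpos]
  have h1 := key x hx _ hg0 hgδ
  rw [hgu] at h1
  have h3 : g x u ^ d ≤ 2 * u / (β * k) := by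
    rw [le_div_iff₀ (by positivity)]
    linarith
  calc g x u = (g x u ^ d) ^ ((1 : ℝ) / d) := by
        rw [one_div, Real.pow_rpow_inv_natCast hg0 hd.ne']
    _ ≤ _ := Real.rpow_le_rpow (by positivity) h3 (by positivity)
end
end

section
/- Let μ be an absolutely continuous measure on ℝ^d with continuous density f, and let W ⊂ ℝ^d be a compact convex set with f > 0 on W. For x ∈ W, r > 0 and k ≥ d+1 let X₁^{(x,r)}, …, X_k^{(x,r)} be independent random points in ℝ^d, each with distribution E ↦ μ(B(x, 2r) ∩ E) / μ(B(x, 2r)), and set p_k(x, r) = P( N(x, Σ_{j=1}^k δ_{X_j^{(x,r)}}) ⊆ B(x, r) ). Let p_k = P( N(0, Σ_{j=1}^k δ_{Y_j}) ⊆ B(0, 1) ), where Y₁, …, Y_k are independent uniformly distributed points in B(0, 2). Then for every integer k ≥ d+1 and every x ∈ W, lim_{r→0⁺} p_k(x, r) = p_k. -/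
open MeasureTheory Filter Topology
open scoped ENNReal NNReal

noncomputable section

/-- The probability `p_k` that the Voronoi cell of the origin generated by `k` independent,
uniformly distributed points in `B(0, 2)` is contained in `B(0, 1)`. -/
def coverProb (d k : ℕ) : ℝ≥0∞ :=
  MeasureTheory.Measure.pi
    (fun _ : Fin k => ProbabilityTheory.cond MeasureTheory.volume (Metric.ball (0 : Euc d) 2))
    {y : Fin k → Euc d |
      {z : Euc d | ∀ j, dist (0 : Euc d) z ≤ dist z (y j)} ⊆ Metric.ball (0 : Euc d) 1}

/-- The constant `α₂ = (2^{d(d+1)} p_{d+1} / (d+1)!)^{1/(d+1)}`. -/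
def alpha2 (d : ℕ) : ℝ :=
  (2 ^ (d * (d + 1)) * (coverProb d (d + 1)).toReal / (Nat.factorial (d + 1)))
    ^ ((1 : ℝ) / (d + 1))


theorem pi_le_of_le {ι α : Type*} [Fintype ι] [MeasurableSpace α] (ν U : Measure α)
    [IsFiniteMeasure ν] [IsFiniteMeasure U] (c : ℝ≥0∞) (hc0 : c ≠ 0) (hc : c ≠ ∞)
    (h : ν ≤ c • U) (s : Set (ι → α)) :
    Measure.pi (fun _ : ι => ν) s ≤ c ^ Fintype.card ι * Measure.pi (fun _ : ι => U) s := by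
  have hk0 : c ^ Fintype.card ι ≠ 0 := pow_ne_zero _ hc0
  have hk : c ^ Fintype.card ι ≠ ∞ := ENNReal.pow_ne_top hc
  have h1 : (c ^ Fintype.card ι)⁻¹ • (Measure.pi (fun _ : ι => ν)).toOuterMeasure ≤
      OuterMeasure.pi (fun _ : ι => U.toOuterMeasure) := by
    rw [OuterMeasure.le_pi]
    intro t _
    change (c ^ Fintype.card ι)⁻¹ * Measure.pi (fun _ : ι => ν) (Set.univ.pi t) ≤ ∏ i, U (t i)
    rw [Measure.pi_pi, ENNReal.inv_mul_le_iff hk0 hk]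
    calc ∏ i, ν (t i) ≤ ∏ i, c * U (t i) := Finset.prod_le_prod' fun i _ => h (t i)
      _ = _ := by rw [Finset.prod_mul_distrib]; simp
  have h2 : Measure.pi (fun _ : ι => ν) ≤ c ^ Fintype.card ι • Measure.pi (fun _ : ι => U) := by
    rw [Measure.le_iff]
    intro t ht
    have h3 := h1 t
    have h4 : Measure.pi (fun _ : ι => U) t = OuterMeasure.pi (fun _ : ι => U.toOuterMeasure) t := by
      rw [Measure.pi]
      exact toMeasure_apply _ _ ht
    change (c ^ Fintype.card ι)⁻¹ * Measure.pi (fun _ : ι => ν) t ≤ _ at h3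
    rw [ENNReal.inv_mul_le_iff hk0 hk, ← h4] at h3
    exact h3
  exact h2 s

theorem unif_scale {d k : ℕ} (x : Euc d) (r : ℝ) (hr : 0 < r) :
    Measure.pi (fun _ : Fin k => ProbabilityTheory.cond volume (Metric.ball x (2 * r)))
      {y : Fin k → Euc d |
        {z : Euc d | ∀ j, dist x z ≤ dist z (y j)} ⊆ Metric.ball x r} = coverProb d k := by
  let e : Euc d ≃ᵐ Euc d :=
    ((Homeomorph.smulOfNeZero r hr.ne').trans (Homeomorph.addLeft x)).toMeasurableEquiv
  have he : ∀ y, e y = x + r • y := fun y => rfl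
  have hed : ∀ y z, dist (e y) (e z) = r * dist y z := by
    intro y z
    rw [he, he, dist_add_left, dist_smul₀, Real.norm_of_nonneg hr.le]
  have he0 : e 0 = x := by simp [he]
  have hball : ∀ ρ, e ⁻¹' (Metric.ball x (ρ * r)) = Metric.ball 0 ρ := by
    intro ρ
    ext y
    rw [Set.mem_preimage, Metric.mem_ball, Metric.mem_ball]
    conv_lhs => rw [← he0, hed, mul_comm ρ r]
    exact mul_lt_mul_iff_right₀ hr
  have hvol : ∀ t : Set (Euc d), volume (e ⁻¹' t) = ENNReal.ofReal |(r ^ d)⁻¹| * volume t := by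
    intro t
    have : e ⁻¹' t = (fun y => r • y) ⁻¹' ((fun y => x + y) ⁻¹' t) := rfl
    rw [this, Measure.addHaar_preimage_smul _ hr.ne', measure_preimage_add]
    simp
  have hmp : MeasurePreserving e (ProbabilityTheory.cond volume (Metric.ball (0 : Euc d) 2))
      (ProbabilityTheory.cond volume (Metric.ball x (2 * r))) := by
    refine ⟨e.measurable, ?_⟩
    ext s hs
    rw [e.map_apply, ProbabilityTheory.cond_apply Metric.isOpen_ball.measurableSet,
      ProbabilityTheory.cond_apply Metric.isOpen_ball.measurableSet, ← hball 2,
      ← Set.preimage_inter, hvol, hvol]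
    have hc0 : ENNReal.ofReal |(r ^ d)⁻¹| ≠ 0 := by
      have : 0 < |(r ^ d)⁻¹| := by positivity
      simpa using this
    have hct : ENNReal.ofReal |(r ^ d)⁻¹| ≠ ∞ := ENNReal.ofReal_ne_top
    rw [ENNReal.mul_inv (Or.inl hc0) (Or.inl hct), mul_mul_mul_comm,
      ENNReal.inv_mul_cancel hc0 hct, one_mul]
  have hU : IsProbabilityMeasure (ProbabilityTheory.cond volume (Metric.ball (0 : Euc d) 2)) :=
    ProbabilityTheory.cond_isProbabilityMeasure_of_finite
      (Metric.measure_ball_pos _ _ (by norm_num)).ne' measure_ball_lt_top.ne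
  have hU' : IsProbabilityMeasure (ProbabilityTheory.cond volume (Metric.ball x (2 * r))) :=
    ProbabilityTheory.cond_isProbabilityMeasure_of_finite
      (Metric.measure_ball_pos _ _ (by positivity)).ne' measure_ball_lt_top.ne
  have hpi := measurePreserving_pi (ι := Fin k) (fun _ => ProbabilityTheory.cond volume (Metric.ball (0 : Euc d) 2))
    (fun _ => ProbabilityTheory.cond volume (Metric.ball x (2 * r))) (fun _ => hmp)
  have hpe : MeasurableEmbedding (fun (y : Fin k → Euc d) i => e (y i)) :=
    (MeasurableEquiv.piCongrRight fun _ : Fin k => e).measurableEmbedding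
  rw [coverProb, ← hpi.measure_preimage_emb hpe]
  congr 1
  ext y
  simp only [Set.mem_preimage, Set.mem_setOf_eq]
  have hcell : {z : Euc d | ∀ j, dist (0 : Euc d) z ≤ dist z (y j)} =
      e ⁻¹' {z : Euc d | ∀ j, dist x z ≤ dist z (e (y j))} := by
    ext z
    simp only [Set.mem_preimage, Set.mem_setOf_eq]
    conv_rhs => rw [← he0]
    simp only [hed, mul_le_mul_iff_right₀ hr]
  have hb := hball 1
  rw [one_mul] at hb
  rw [hcell, ← hb]
  exact (e.surjective.preimage_subset_preimage_iff).symm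

theorem cond_le_aux {α : Type*} [MeasurableSpace α] (μ ν : Measure α) (B : Set α)
    (hB : MeasurableSet B) (m M : ℝ≥0∞) (hm : m ≠ 0) (hmt : m ≠ ∞)
    (h1 : m * ν B ≤ μ B) (h2 : ∀ s ⊆ B, MeasurableSet s → μ s ≤ M * ν s) :
    ProbabilityTheory.cond μ B ≤ (M / m) • ProbabilityTheory.cond ν B := by
  rw [Measure.le_iff]
  intro s hs
  rw [Measure.smul_apply, smul_eq_mul, ProbabilityTheory.cond_apply hB,
    ProbabilityTheory.cond_apply hB]
  calc (μ B)⁻¹ * μ (B ∩ s) ≤ (m * ν B)⁻¹ * (M * ν (B ∩ s)) :=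
        mul_le_mul' (ENNReal.inv_le_inv.2 h1) (h2 _ Set.inter_subset_left (hB.inter hs))
    _ = M / m * ((ν B)⁻¹ * ν (B ∩ s)) := by
        rw [ENNReal.mul_inv (Or.inl hm) (Or.inl hmt), div_eq_mul_inv]
        ring

/-- (Lemma 8 of the paper.) For `k ≥ d + 1` and `x ∈ W`, the probability
`p_k(x, r)` that the Voronoi cell of `x` generated by `k` independent points distributed
according to `μ(B(x,2r) ∩ ·)/μ(B(x,2r))` is contained in `B(x, r)` converges, as
`r → 0⁺`, to `p_k`. -/
theorem voronoi_cover_probability_limit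
    {d : ℕ} (hd : 0 < d)
    -- the absolutely continuous measure `μ` with continuous density `f`
    (f : Euc d → ℝ) (hfc : Continuous f) (hf0 : ∀ x, 0 ≤ f x)
    (μ : Measure (Euc d)) (hμ : μ = volume.withDensity fun x => ENNReal.ofReal (f x))
    -- the compact convex set `W`, with `f > 0` on `W`
    (W : Set (Euc d)) (hW : IsCompact W) (hWc : Convex ℝ W) (hfW : ∀ x ∈ W, 0 < f x) :
    ∀ k : ℕ, d + 1 ≤ k → ∀ x ∈ W,
      Tendsto
        (fun r : ℝ =>
          ((Measure.pi fun _ : Fin k => ProbabilityTheory.cond μ (Metric.ball x (2 * r)))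
              {y : Fin k → Euc d |
                {z : Euc d | ∀ j, dist x z ≤ dist z (y j)} ⊆ Metric.ball x r}).toReal)
        (nhdsWithin 0 (Set.Ioi 0)) (𝓝 ((coverProb d k).toReal)) := by
  intro k _ x hx
  have hfx := hfW x hx
  set p := coverProb d k with hp
  have hU0 : IsProbabilityMeasure (ProbabilityTheory.cond volume (Metric.ball (0 : Euc d) 2)) :=
    ProbabilityTheory.cond_isProbabilityMeasure_of_finite
      (Metric.measure_ball_pos _ _ (by norm_num)).ne' measure_ball_lt_top.ne
  have hpt : p ≠ ∞ := by
    rw [hp, coverProb]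
    exact measure_ne_top _ _
  -- the sandwich
  have key : ∀ ε : ℝ, 0 < ε → ε < f x → ∀ᶠ r in nhdsWithin (0 : ℝ) (Set.Ioi 0),
      ((f x - ε) / (f x + ε)) ^ k * p.toReal ≤
        ((Measure.pi fun _ : Fin k => ProbabilityTheory.cond μ (Metric.ball x (2 * r)))
              {y : Fin k → Euc d |
                {z : Euc d | ∀ j, dist x z ≤ dist z (y j)} ⊆ Metric.ball x r}).toReal ∧
        ((Measure.pi fun _ : Fin k => ProbabilityTheory.cond μ (Metric.ball x (2 * r)))
              {y : Fin k → Euc d |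
                {z : Euc d | ∀ j, dist x z ≤ dist z (y j)} ⊆ Metric.ball x r}).toReal ≤
        ((f x + ε) / (f x - ε)) ^ k * p.toReal := by
    intro ε hε hεf
    obtain ⟨δ, hδ, hfδ⟩ := Metric.continuousAt_iff.1 hfc.continuousAt ε hε
    have hev : Set.Ioo (0 : ℝ) (δ / 2) ∈ nhdsWithin (0 : ℝ) (Set.Ioi 0) :=
      Ioo_mem_nhdsGT (by positivity)
    filter_upwards [hev] with r hr
    obtain ⟨hr0, hrδ⟩ := hr
    have hB : MeasurableSet (Metric.ball x (2 * r)) := Metric.isOpen_ball.measurableSet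
    have hm0 : 0 < f x - ε := by linarith
    have hM0 : 0 < f x + ε := by linarith
    set m := ENNReal.ofReal (f x - ε) with hm
    set M := ENNReal.ofReal (f x + ε) with hM
    have hmne : m ≠ 0 := by simpa [hm] using hm0
    have hMne : M ≠ 0 := by simpa [hM] using hM0
    have hmt : m ≠ ∞ := ENNReal.ofReal_ne_top
    have hMt : M ≠ ∞ := ENNReal.ofReal_ne_top
    have hfb : ∀ y ∈ Metric.ball x (2 * r), f x - ε ≤ f y ∧ f y ≤ f x + ε := by
      intro y hy
      have := hfδ (lt_of_lt_of_le (Metric.mem_ball.1 hy) (by linarith))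
      rw [Real.dist_eq, abs_lt] at this
      constructor <;> linarith [this.1, this.2]
    have hup : ∀ s ⊆ Metric.ball x (2 * r), MeasurableSet s → μ s ≤ M * volume s := by
      intro s hs hms
      rw [hμ, withDensity_apply _ hms, ← setLIntegral_const]
      exact setLIntegral_mono' hms fun y hy => ENNReal.ofReal_le_ofReal (hfb y (hs hy)).2
    have hlo : ∀ s ⊆ Metric.ball x (2 * r), MeasurableSet s → m * volume s ≤ μ s := by
      intro s hs hms
      rw [hμ, withDensity_apply _ hms, ← setLIntegral_const]
      exact setLIntegral_mono' hms fun y hy => ENNReal.ofReal_le_ofReal (hfb y (hs hy)).1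
    have hv0 : volume (Metric.ball x (2 * r)) ≠ 0 :=
      (Metric.measure_ball_pos _ _ (by positivity)).ne'
    have hvt : volume (Metric.ball x (2 * r)) ≠ ∞ := measure_ball_lt_top.ne
    have hμ0 : μ (Metric.ball x (2 * r)) ≠ 0 := fun h0 => by
      have := hlo _ subset_rfl hB
      rw [h0, nonpos_iff_eq_zero, mul_eq_zero] at this
      exact this.elim hmne hv0
    have hμt : μ (Metric.ball x (2 * r)) ≠ ∞ :=
      ne_top_of_le_ne_top (ENNReal.mul_ne_top hMt hvt) (hup _ subset_rfl hB)
    have hP1 : IsProbabilityMeasure (ProbabilityTheory.cond volume (Metric.ball x (2 * r))) :=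
      ProbabilityTheory.cond_isProbabilityMeasure_of_finite hv0 hvt
    have hP2 : IsProbabilityMeasure (ProbabilityTheory.cond μ (Metric.ball x (2 * r))) :=
      ProbabilityTheory.cond_isProbabilityMeasure_of_finite hμ0 hμt
    have hle1 := cond_le_aux μ volume _ hB m M hmne hmt (hlo _ subset_rfl hB) hup
    have hle2 := cond_le_aux volume μ _ hB M⁻¹ m⁻¹ (ENNReal.inv_ne_zero.2 hMt)
      (ENNReal.inv_ne_top.2 hMne)
      ((ENNReal.inv_mul_le_iff hMne hMt).2 (hup _ subset_rfl hB))
      (fun s hs hms => by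
        rw [mul_comm, ← div_eq_mul_inv, ENNReal.le_div_iff_mul_le (Or.inl hmne) (Or.inl hmt),
          mul_comm]
        exact hlo s hs hms)
    have hc : m⁻¹ / M⁻¹ = M / m := by
      rw [div_eq_mul_inv, inv_inv, mul_comm, div_eq_mul_inv]
    rw [hc] at hle2
    have hMm : M / m = ENNReal.ofReal ((f x + ε) / (f x - ε)) :=
      (ENNReal.ofReal_div_of_pos hm0).symm
    have hq : 0 < (f x + ε) / (f x - ε) := by positivity
    have hne0 : M / m ≠ 0 := by rw [hMm]; simpa using hq
    have hnet : M / m ≠ ∞ := by rw [hMm]; exact ENNReal.ofReal_ne_top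
    set S := {y : Fin k → Euc d |
                {z : Euc d | ∀ j, dist x z ≤ dist z (y j)} ⊆ Metric.ball x r} with hS
    have e1 := pi_le_of_le (ι := Fin k) _ _ _ hne0 hnet hle1 S
    have e2 := pi_le_of_le (ι := Fin k) _ _ _ hne0 hnet hle2 S
    have hu := unif_scale (k := k) x r hr0
    rw [← hS, ← hp] at hu
    rw [hu, Fintype.card_fin] at e1 e2
    have hreal : (M / m).toReal = (f x + ε) / (f x - ε) := by
      rw [hMm, ENNReal.toReal_ofReal hq.le]
    have e1' := ENNReal.toReal_mono (ENNReal.mul_ne_top (ENNReal.pow_ne_top hnet) hpt) e1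
    have e2' := ENNReal.toReal_mono
      (ENNReal.mul_ne_top (ENNReal.pow_ne_top hnet) (measure_ne_top _ _)) e2
    rw [ENNReal.toReal_mul, ENNReal.toReal_pow, hreal] at e1' e2'
    refine ⟨?_, e1'⟩
    rw [← inv_div, inv_pow, inv_mul_le_iff₀ (by positivity)]
    exact e2'
  have hlim1 : Tendsto (fun ε : ℝ => ((f x - ε) / (f x + ε)) ^ k * p.toReal)
      (nhdsWithin 0 (Set.Ioi 0)) (𝓝 p.toReal) := by
    have : ContinuousAt (fun ε : ℝ => ((f x - ε) / (f x + ε)) ^ k * p.toReal) 0 := by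
      have : f x + 0 ≠ 0 := by linarith
      fun_prop (disch := assumption)
    have h := this.tendsto.mono_left (nhdsWithin_le_nhds (s := Set.Ioi 0))
    simpa [hfx.ne'] using h
  have hlim2 : Tendsto (fun ε : ℝ => ((f x + ε) / (f x - ε)) ^ k * p.toReal)
      (nhdsWithin 0 (Set.Ioi 0)) (𝓝 p.toReal) := by
    have : ContinuousAt (fun ε : ℝ => ((f x + ε) / (f x - ε)) ^ k * p.toReal) 0 := by
      have : f x - 0 ≠ 0 := by linarith
      fun_prop (disch := assumption)
    have h := this.tendsto.mono_left (nhdsWithin_le_nhds (s := Set.Ioi 0))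
    simpa [hfx.ne'] using h
  have hεev : Set.Ioo (0 : ℝ) (f x) ∈ nhdsWithin (0 : ℝ) (Set.Ioi 0) := Ioo_mem_nhdsGT hfx
  rw [tendsto_order]
  constructor
  · intro a ha
    obtain ⟨ε, hε1, hε⟩ := ((hlim1.eventually (lt_mem_nhds ha)).and hεev).exists
    filter_upwards [key ε hε.1 hε.2] with r hr
    exact hε1.trans_le hr.1
  · intro a ha
    obtain ⟨ε, hε1, hε⟩ := ((hlim2.eventually (gt_mem_nhds ha)).and hεev).exists
    filter_upwards [key ε hε.1 hε.2] with r hr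
    exact hr.2.trans_lt hε1
end
end

section
/- Let x₀, x₁, …, x_{d+1} ∈ ℝ^d be in general position (no k-dimensional affine subspace of ℝ^d with k ∈ {0, …, d−1} contains more than k+1 of the points), and assume that the Voronoi cell N(x₀, Σ_{j=0}^{d+1} δ_{x_j}) is bounded. Then: (a) x₀ lies in the interior of the convex hull of {x₁, …, x_{d+1}}; (b) for every i ∈ {1, …, d+1}, the Voronoi cell N(x_i, Σ_{j=0}^{d+1} δ_{x_j}) is unbounded. -/
open Bornology

noncomputable section

/-- The Voronoi cell with nucleus `x i` generated by the points `x 0, …, x (m-1)`: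
`{y : ‖x i − y‖ ≤ ‖y − x j‖ for all j with x j ≠ x i}`. -/
def voronoiCellOf {d m : ℕ} (x : Fin m → Euc d) (i : Fin m) : Set (Euc d) :=
  {y | ∀ j, x j ≠ x i → dist (x i) y ≤ dist y (x j)}

open scoped InnerProductSpace

lemma voronoi_ray {d m : ℕ} (x : Fin m → Euc d) (i : Fin m) (u : Euc d) (hu : u ≠ 0)
    (h : ∀ j, ⟪u, x j⟫_ℝ ≤ ⟪u, x i⟫_ℝ) : ¬ IsBounded (voronoiCellOf x i) := by
  intro hb
  obtain ⟨R, hR⟩ := hb.subset_closedBall (x i)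
  have hu' : 0 < ‖u‖ := norm_pos_iff.mpr hu
  have key : ∀ t : ℝ, 0 ≤ t → x i + t • u ∈ voronoiCellOf x i := by
    intro t ht j _
    rw [dist_comm, dist_eq_norm, dist_eq_norm]
    have e2 : x i + t • u - x j = t • u + (x i - x j) := by abel
    rw [add_sub_cancel_left, e2]
    refine le_of_sq_le_sq ?_ (norm_nonneg _)
    rw [norm_add_sq_real, inner_smul_left, inner_sub_right]
    have := mul_nonneg ht (sub_nonneg.mpr (h j))
    simp only [conj_trivial]
    nlinarith [sq_nonneg ‖x i - x j‖]
  have h1 := hR (key ((|R| + 1) / ‖u‖) (by positivity))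
  rw [Metric.mem_closedBall, dist_eq_norm, add_sub_cancel_left, norm_smul, Real.norm_eq_abs,
    abs_of_nonneg (by positivity), div_mul_cancel₀ _ hu'.ne'] at h1
  linarith [le_abs_self R]

lemma voronoi_interior {d m : ℕ} (x : Fin m → Euc d) (i : Fin m) (hne : ∃ k, k ≠ i)
    (hb : IsBounded (voronoiCellOf x i)) :
    x i ∈ interior (convexHull ℝ (x '' {j | j ≠ i})) := by
  by_contra hx
  obtain ⟨k, hk⟩ := hne
  by_cases hInt : (interior (convexHull ℝ (x '' {j | j ≠ i}))).Nonempty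
  · have hc : Convex ℝ (convexHull ℝ (x '' {j | j ≠ i})) := convex_convexHull ℝ _
    obtain ⟨f, hf⟩ := geometric_hahn_banach_open_point hc.interior isOpen_interior hx
    have hle : ∀ a ∈ convexHull ℝ (x '' {j | j ≠ i}), f a ≤ f (x i) := by
      intro a ha
      have ha' : a ∈ closure (interior (convexHull ℝ (x '' {j | j ≠ i}))) := by
        rw [hc.closure_interior_eq_closure_of_nonempty_interior hInt]
        exact subset_closure ha
      have hcl : IsClosed {a | f a ≤ f (x i)} := isClosed_le f.continuous continuous_const
      exact closure_minimal (fun b hb => (hf b hb).le) hcl ha'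
    have hin : ∀ y, ⟪(InnerProductSpace.toDual ℝ (Euc d)).symm f, y⟫_ℝ = f y := fun y =>
      InnerProductSpace.toDual_symm_apply
    refine voronoi_ray x i ((InnerProductSpace.toDual ℝ (Euc d)).symm f) ?_ ?_ hb
    · intro h0
      obtain ⟨a, ha⟩ := hInt
      have := hf a ha
      rw [← hin, ← hin, h0] at this
      simp at this
    · intro j
      rw [hin, hin]
      by_cases hj : j = i
      · rw [hj]
      · exact hle _ (subset_convexHull ℝ _ ⟨j, hj, rfl⟩)
  · rw [interior_convexHull_nonempty_iff_affineSpan_eq_top] at hInt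
    have hkm : x k ∈ affineSpan ℝ (x '' {j | j ≠ i}) := subset_affineSpan ℝ _ ⟨k, hk, rfl⟩
    have hdir : (affineSpan ℝ (x '' {j | j ≠ i})).direction ≠ ⊤ := by
      rwa [Ne, AffineSubspace.direction_eq_top_iff_of_nonempty ⟨_, hkm⟩]
    have horth : (affineSpan ℝ (x '' {j | j ≠ i})).directionᗮ ≠ ⊥ := by
      rwa [Ne, Submodule.orthogonal_eq_bot_iff]
    obtain ⟨u, hu, hu0⟩ := Submodule.exists_mem_ne_zero_of_ne_bot horth
    have hconst : ∀ j, j ≠ i → ⟪u, x j⟫_ℝ = ⟪u, x k⟫_ℝ := by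
      intro j hj
      have hjm : x j ∈ affineSpan ℝ (x '' {j | j ≠ i}) := subset_affineSpan ℝ _ ⟨j, hj, rfl⟩
      have := (Submodule.mem_orthogonal' _ _).mp hu _ (AffineSubspace.vsub_mem_direction hjm hkm)
      rw [vsub_eq_sub, inner_sub_right] at this
      linarith
    rcases le_total ⟪u, x k⟫_ℝ ⟪u, x i⟫_ℝ with hle | hle
    · refine voronoi_ray x i u hu0 (fun j => ?_) hb
      by_cases hj : j = i
      · rw [hj]
      · rw [hconst j hj]; exact hle
    · refine voronoi_ray x i (-u) (neg_ne_zero.mpr hu0) (fun j => ?_) hb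
      rw [inner_neg_left, inner_neg_left]
      by_cases hj : j = i
      · rw [hj]
      · rw [hconst j hj]; exact neg_le_neg hle

lemma hull_all {d m : ℕ} (x : Fin m → Euc d) (i : Fin m)
    (h : x i ∈ convexHull ℝ (x '' {j | j ≠ i})) :
    convexHull ℝ (Set.range x) = convexHull ℝ (x '' {j | j ≠ i}) := by
  apply Set.Subset.antisymm
  · refine convexHull_min ?_ (convex_convexHull ℝ _)
    rintro _ ⟨j, rfl⟩
    by_cases hj : j = i
    · rw [hj]; exact h
    · exact subset_convexHull ℝ _ ⟨j, hj, rfl⟩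
  · exact convexHull_mono (Set.image_subset_range _ _)

/-- (Lemma 10 of the paper.) If `x 0, …, x (d+1) ∈ ℝ^d` are in general
position and the Voronoi cell of `x 0` generated by all `d + 2` points is bounded, then
(a) `x 0` lies in the interior of the convex hull of the other points, and (b) all the
other Voronoi cells are unbounded. -/
theorem voronoi_bounded_cell_structure
    {d : ℕ} (hd : 0 < d) (x : Fin (d + 2) → Euc d)
    -- general position: no `k`-dimensional affine subspace, `k ∈ {0, …, d−1}`,
    -- contains more than `k + 1` of the points
    (hgen : ∀ k : ℕ, k < d → ∀ A : AffineSubspace ℝ (Euc d),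
      Module.finrank ℝ A.direction = k → Set.ncard {i | x i ∈ A} ≤ k + 1)
    -- the Voronoi cell of `x 0` is bounded
    (hbdd : IsBounded (voronoiCellOf x 0)) :
    -- (a)
    x 0 ∈ interior (convexHull ℝ (x '' {i | i ≠ 0})) ∧
    -- (b)
    ∀ i : Fin (d + 2), i ≠ 0 → ¬ IsBounded (voronoiCellOf x i) := by
  have ha : x 0 ∈ interior (convexHull ℝ (x '' {i | i ≠ 0})) :=
    voronoi_interior x 0 ⟨1, by simp⟩ hbdd
  refine ⟨ha, fun i hi hb => ?_⟩
  have hbi := voronoi_interior x i ⟨0, hi.symm⟩ hb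
  have hinj : Function.Injective x := by
    intro a b hab
    by_contra hne
    have h1 := hgen 0 hd (affineSpan ℝ {x a}) (by
      rw [direction_affineSpan, vectorSpan_singleton]; simp)
    have h2 : ({a, b} : Set (Fin (d + 2))) ⊆ {i | x i ∈ affineSpan ℝ {x a}} := by
      rintro j (rfl | rfl)
      · exact subset_affineSpan ℝ _ rfl
      · exact subset_affineSpan ℝ _ hab.symm
    have h3 := Set.ncard_le_ncard h2 (Set.toFinite _)
    rw [Set.ncard_pair hne] at h3
    omega
  have e0 := hull_all x 0 (interior_subset ha)
  have ei := hull_all x i (interior_subset hbi)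
  have hext : (convexHull ℝ (Set.range x)).extremePoints ℝ ⊆ x '' {j | j ≠ 0 ∧ j ≠ i} := by
    intro p hp
    have hp0 := hp
    rw [e0] at hp0
    rw [ei] at hp
    obtain ⟨j, hj, rfl⟩ := extremePoints_convexHull_subset hp0
    obtain ⟨l, hl, hlj⟩ := extremePoints_convexHull_subset hp
    have := hinj hlj
    subst this
    exact ⟨l, ⟨hj, hl⟩, rfl⟩
  have hcomp : IsCompact (convexHull ℝ (Set.range x)) :=
    (Set.finite_range x).isCompact_convexHull ℝ
  have hkm := closure_convexHull_extremePoints hcomp (convex_convexHull ℝ _)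
  have hfin : (x '' {j | j ≠ 0 ∧ j ≠ i}).Finite := Set.toFinite _
  have hsub : convexHull ℝ (Set.range x) ⊆ convexHull ℝ (x '' {j | j ≠ 0 ∧ j ≠ i}) := by
    rw [← hkm]
    exact closure_minimal (convexHull_mono hext) (hfin.isCompact_convexHull ℝ).isClosed
  rw [← e0] at ha
  have hne : (interior (convexHull ℝ (x '' {j | j ≠ 0 ∧ j ≠ i}))).Nonempty :=
    ⟨_, interior_mono hsub ha⟩
  rw [interior_convexHull_nonempty_iff_affineSpan_eq_top] at hne
  have hcard : ((Finset.univ.erase (0 : Fin (d + 2))).erase i).card = (d - 1) + 1 := by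
    rw [Finset.card_erase_of_mem (by simp [hi]), Finset.card_erase_of_mem (by simp)]
    simp
    omega
  have hrank := finrank_vectorSpan_image_finset_le ℝ x _ hcard
  have hset : (((Finset.univ.erase (0 : Fin (d + 2))).erase i).image x : Set (Euc d)) =
      x '' {j | j ≠ 0 ∧ j ≠ i} := by
    ext p
    simp [and_comm]
  rw [hset, ← direction_affineSpan, hne, AffineSubspace.direction_top, finrank_top,
    finrank_euclideanSpace_fin] at hrank
  omega
end
end
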